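/- Let Σ be a finite subset of ℕ* with |Σ| < q and let n ∈ ℕ. For all d ∈ ℕ one has, in the polynomial ring over K in the variables t_i (i ∈ Σ): S_d(Σ; n+1) = S_d(n+1) · ∏_{i∈Σ} b_d(t_i) + Σ_{J ⊊ Σ, I = Σ∖J} Σ_{(k_i)_{i∈I}: 0 ≤ k_i ≤ d−1 for all i ∈ I, and n − Σ_{i∈I} q^{k_i} + 1 > 0} S_d( n − Σ_{i∈I} q^{k_i} + 1 ) · ∏_{i∈I} Q_{d,k_i}(t_i) · ∏_{i∈J} b_d(t_i), where the outer sum is over proper subsets J of Σ with complement I. -/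

import Mathlib

/-!
STATEMENT 11: Let `Σ` be a finite subset of `ℕ*` with `|Σ| < q` and `n ∈ ℕ`.
For all `d ∈ ℕ`, in the polynomial ring over `K = F_q(θ)` in the variables
`t_i`:
`S_d(Σ; n+1) = S_d(n+1)·∏_{i∈Σ} b_d(t_i)
  + Σ_{J ⊊ Σ, I = Σ∖J} Σ_{(k_i)_{i∈I}, 0 ≤ k_i ≤ d−1, n − Σ_{i∈I} q^{k_i} + 1 > 0}
      S_d(n − Σ_{i∈I} q^{k_i} + 1) · ∏_{i∈I} Q_{d,k_i}(t_i) · ∏_{i∈J} b_d(t_i)`.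
Here `S_d(Σ; s) = Σ_{a∈A^+(d)} (∏_{i∈Σ} a(t_i))/a^s`, `S_d(s) = Σ_{a∈A^+(d)} a^{−s}`,
`b_d(t) = ∏_{m<d}(t − θ^{q^m})`, and
`Q_{d,k}(t) = Σ_{j=k}^{d−1} b_j(t)/(D_k ℓ_{j−k}^{q^k})` (an empty sum being `0`).
The tuples `(k_i)_{i∈I}` with `0 ≤ k_i ≤ d−1` are parametrized by functions
`I → Fin d`, and the condition `n − Σ q^{k_i} + 1 > 0` by `Σ q^{k_i} ≤ n`.
-/

open Polynomial Finset

noncomputable section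

variable (Fq : Type) [Field Fq] [Fintype Fq]

/-- `q`, the cardinality of the base field. -/
abbrev q := Fintype.card Fq

/-- `θ` as an element of `K = F_q(θ)`. -/
def th : RatFunc Fq := algebraMap (Polynomial Fq) (RatFunc Fq) Polynomial.X

/-- `a` as an element of `K`. -/
def aK (a : Polynomial Fq) : RatFunc Fq := algebraMap (Polynomial Fq) (RatFunc Fq) a

/-- The canonical map `F_q → K`. -/
def FqK : Fq →+* RatFunc Fq :=
  (algebraMap (Polynomial Fq) (RatFunc Fq)).comp Polynomial.C

/-- The monic polynomial `θ^d + Σ_{i<d} c_i θ^i`; as `c` ranges over `Fin d → Fq`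
these are exactly the elements of `A^+(d)`. -/
def mP (d : ℕ) (c : Fin d → Fq) : Polynomial Fq :=
  Polynomial.X ^ d + ∑ i : Fin d, Polynomial.C (c i) * Polynomial.X ^ (i : ℕ)

/-- `D_d = ∏_{i<d} (θ^{q^d} − θ^{q^i})`, with `D_0 = 1`. -/
def Dd (d : ℕ) : RatFunc Fq := ∏ i ∈ Finset.range d, (th Fq ^ q Fq ^ d - th Fq ^ q Fq ^ i)

/-- `ℓ_d = ∏_{i=1}^{d} (θ − θ^{q^i})`, with `ℓ_0 = 1`. -/
def ld (d : ℕ) : RatFunc Fq := ∏ i ∈ Finset.Icc 1 d, (th Fq - th Fq ^ q Fq ^ i)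

/-- `a(t_i)`: substitute `θ` by the indeterminate `t_i` in `a ∈ A`. -/
def tval (i : ℕ+) (a : Polynomial Fq) : MvPolynomial ℕ+ (RatFunc Fq) :=
  Polynomial.eval₂ ((MvPolynomial.C : RatFunc Fq →+* MvPolynomial ℕ+ (RatFunc Fq)).comp (FqK Fq))
    (MvPolynomial.X i) a

/-- The scalar power sum `S_d(s) = Σ_{a∈A^+(d)} a^{−s} ∈ K`. -/
def Ssc (d : ℕ) (s : ℕ) : RatFunc Fq := ∑ c : Fin d → Fq, ((aK Fq (mP Fq d c)) ^ s)⁻¹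

/-- The power sum `S_d(Σ; s) = Σ_{a∈A^+(d)} (∏_{i∈Σ} a(t_i))/a^s` for a finite
subset `Σ` of `ℕ*`. -/
def SdF (d : ℕ) (Sg : Finset ℕ+) (s : ℕ) : MvPolynomial ℕ+ (RatFunc Fq) :=
  ∑ c : Fin d → Fq, (∏ i ∈ Sg, tval Fq i (mP Fq d c)) *
    MvPolynomial.C ((aK Fq (mP Fq d c)) ^ s)⁻¹

/-- `b_d(t_i) = ∏_{m<d} (t_i − θ^{q^m})` as a polynomial in the variable `t_i`. -/
def bMv (d : ℕ) (i : ℕ+) : MvPolynomial ℕ+ (RatFunc Fq) :=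
  ∏ m ∈ Finset.range d, (MvPolynomial.X i - MvPolynomial.C (th Fq ^ q Fq ^ m))

/-- `Q_{d,k}(t_i) = Σ_{j=k}^{d−1} b_j(t_i)/(D_k ℓ_{j−k}^{q^k})`, with the
convention that an empty sum is `0`. -/
def Q (d k : ℕ) (i : ℕ+) : MvPolynomial ℕ+ (RatFunc Fq) :=
  ∑ j ∈ Finset.Ico k d, MvPolynomial.C ((Dd Fq k * (ld Fq (j - k)) ^ q Fq ^ k)⁻¹) * bMv Fq j i

/-- Newton's form of the interpolation polynomial, with the divided differences written out. -/
theorem eq_sum_dividedDifference_mul_nodal {F : Type*} [Field F] {v : ℕ → F}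
    (hv : Function.Injective v) (N : ℕ) (P : F[X]) (hP : P.degree < N) :
    P = ∑ j ∈ range N,
      Polynomial.C (∑ k ∈ range (j + 1),
        P.eval (v k) / ∏ i ∈ (range (j + 1)).erase k, (v k - v i)) *
      ∏ i ∈ range j, (Polynomial.X - Polynomial.C (v i)) := by
  induction N generalizing P with
  | zero => simpa using hP
  | succ N ih =>
    have hc := Lagrange.coeff_eq_sum (s := range (N + 1)) (v := v) hv.injOn (P := P)
      (by simpa using hP)
    rw [card_range, Nat.add_sub_cancel] at hc
    set B : F[X] := ∏ i ∈ range N, (Polynomial.X - Polynomial.C (v i)) with hB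
    have hBm : B.Monic := monic_prod_of_monic _ _ fun i _ => monic_X_sub_C _
    have hBd : B.natDegree = N := by simp [hB, natDegree_prod_of_monic, monic_X_sub_C]
    have hdeg : (P - Polynomial.C (P.coeff N) * B).degree < N := by
      rw [degree_lt_iff_coeff_zero]
      intro m hm
      rcases hm.eq_or_lt with rfl | hlt
      · have : B.coeff N = 1 := by rw [← hBd]; exact hBm.coeff_natDegree
        simp [this]
      · rw [coeff_sub, coeff_C_mul, coeff_eq_zero_of_natDegree_lt (hBd.trans_lt hlt),
          coeff_eq_zero_of_degree_lt (hP.trans_le (by exact_mod_cast hlt))]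
        simp
    have heval (k : ℕ) (hk : k < N) : B.eval (v k) = 0 := by
      rw [hB, eval_prod]
      exact prod_eq_zero (mem_range.2 hk) (by simp)
    rw [sum_range_succ, ← hc, ← hB, ← sub_eq_iff_eq_add]
    refine (ih _ hdeg).trans (sum_congr rfl fun j hj => ?_)
    congr 2
    refine sum_congr rfl fun k hk => ?_
    rw [mem_range] at hj hk
    simp [heval k (by omega)]

/-- The Chevalley–Warning vanishing of sums over affine space, for coefficients in an extension of
the finite field. -/
theorem sum_eval₂_eq_zero {k R σ : Type*} [Field k] [Fintype k] [CommRing R] [Fintype σ]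
    [DecidableEq σ] (φ : k →+* R) (f : MvPolynomial σ R)
    (h : f.totalDegree < (Fintype.card k - 1) * Fintype.card σ) :
    ∑ x : σ → k, MvPolynomial.eval (fun i => φ (x i)) f = 0 := by
  simp only [MvPolynomial.eval_eq']
  rw [sum_comm]
  refine sum_eq_zero fun e he => ?_
  obtain ⟨i, hi⟩ := f.exists_degree_lt _ h he
  have := Fintype.prod_sum fun (i : σ) (x : k) => x ^ e i
  rw [prod_eq_zero (mem_univ i) (FiniteField.sum_pow_lt_card_sub_one k _ hi)] at this
  rw [← mul_sum]
  have h2 := congrArg φ this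
  simp only [map_zero, map_sum, map_prod, map_pow] at h2
  rw [← h2, mul_zero]

/-- A power of an affine form with exponent below `(q - 1) q ^ e` agrees on `F_q`-rational points
with a polynomial of total degree less than `(q - 1) (e + 1)`. -/
theorem exists_totalDegree_lt_eval_eq_pow {k R σ : Type*} [Field k] [Fintype k] [CommRing R]
    [Nontrivial R] [Algebra k R] [Fintype σ] (e : ℕ) :
    ∀ (m : ℕ), m < (Fintype.card k - 1) * Fintype.card k ^ e → ∀ (α : R) (β : σ → R),
    ∃ f : MvPolynomial σ R, f.totalDegree < (Fintype.card k - 1) * (e + 1) ∧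
      ∀ x : σ → k, MvPolynomial.eval (fun i => algebraMap k R (x i)) f =
        (α + ∑ i, algebraMap k R (x i) * β i) ^ m := by
  have key (m : ℕ) (α : R) (β : σ → R) : ∃ f : MvPolynomial σ R, f.totalDegree ≤ m ∧
      ∀ x : σ → k, MvPolynomial.eval (fun i => algebraMap k R (x i)) f =
        (α + ∑ i, algebraMap k R (x i) * β i) ^ m := by
    refine ⟨(MvPolynomial.C α + ∑ i, MvPolynomial.X i * MvPolynomial.C (β i)) ^ m, ?_, ?_⟩
    · refine (MvPolynomial.totalDegree_pow _ _).trans (mul_le_of_le_one_right' ?_)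
      refine (MvPolynomial.totalDegree_add _ _).trans (max_le (by simp) ?_)
      refine MvPolynomial.totalDegree_finsetSum_le fun i _ => ?_
      exact (MvPolynomial.totalDegree_mul _ _).trans (by simp)
    · simp
  induction e with
  | zero =>
    intro m hm α β
    obtain ⟨f, hf, hx⟩ := key m α β
    exact ⟨f, by simpa using hf.trans_lt (by simpa using hm), hx⟩
  | succ e ih =>
    intro m hm α β
    have hq : 0 < Fintype.card k := Fintype.card_pos
    obtain ⟨f, hf, hfx⟩ := ih (m / Fintype.card k)
      (by rw [Nat.div_lt_iff_lt_mul hq]; convert hm using 1; ring)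
      (α ^ Fintype.card k) (fun i => β i ^ Fintype.card k)
    obtain ⟨g, hg, hgx⟩ := key (m % Fintype.card k) α β
    refine ⟨f * g, (MvPolynomial.totalDegree_mul _ _).trans_lt ?_, fun x => ?_⟩
    · have := Nat.mod_lt m hq
      have e1 : (Fintype.card k - 1) * (e + 1 + 1) =
        (Fintype.card k - 1) * (e + 1) + (Fintype.card k - 1) := by ring
      omega
    · have hfr : (α + ∑ i, algebraMap k R (x i) * β i) ^ Fintype.card k =
          α ^ Fintype.card k + ∑ i, algebraMap k R (x i) * β i ^ Fintype.card k := by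
        have := map_add (FiniteField.frobeniusAlgHom k R) α (∑ i, algebraMap k R (x i) * β i)
        simpa [map_sum, map_mul] using this
      rw [map_mul, hfx, hgx, ← hfr, ← pow_mul, ← pow_add, Nat.div_add_mod]

theorem sub_pow_card_pow {k R : Type*} [Field k] [Fintype k] [CommRing R] [Algebra k R]
    (x y : R) (j : ℕ) :
    (x - y) ^ Fintype.card k ^ j = x ^ Fintype.card k ^ j - y ^ Fintype.card k ^ j := by
  induction j with
  | zero => simp
  | succ j ih =>
    rw [pow_succ, pow_mul, pow_mul, pow_mul, ih]
    simpa using map_sub (FiniteField.frobeniusAlgHom k R) (x ^ Fintype.card k ^ j)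
      (y ^ Fintype.card k ^ j)

theorem injective_th_pow : Function.Injective fun i : ℕ => th Fq ^ q Fq ^ i := by
  intro i j h
  simp only [th, ← map_pow] at h
  have h2 := congrArg natDegree (RatFunc.algebraMap_injective Fq h)
  simp only [natDegree_X_pow] at h2
  exact Nat.pow_right_injective Fintype.one_lt_card h2

theorem prod_erase_sub_th_pow {j k : ℕ} (hk : k ≤ j) :
    ∏ i ∈ (range (j + 1)).erase k, (th Fq ^ q Fq ^ k - th Fq ^ q Fq ^ i) =
      Dd Fq k * ld Fq (j - k) ^ q Fq ^ k := by
  have hs : (range (j + 1)).erase k = range k ∪ Ico (k + 1) (j + 1) := by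
    ext i; simp; omega
  have hd : Disjoint (range k) (Ico (k + 1) (j + 1)) := by
    rw [disjoint_left]; intro i; simp; omega
  rw [hs, prod_union hd, Dd, ld, ← prod_pow]
  congr 1
  have hI : Ico (k + 1) (j + 1) = (Icc 1 (j - k)).image (k + ·) := by
    ext i
    simp only [mem_Ico, mem_image, mem_Icc]
    exact ⟨fun h => ⟨i - k, by omega⟩, by rintro ⟨a, h⟩; omega⟩
  rw [hI, prod_image (by intro a _ b _ h; simpa using h)]
  refine prod_congr rfl fun i _ => ?_
  rw [sub_pow_card_pow (k := Fq), ← pow_mul, ← pow_add, Nat.add_comm i]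

theorem mP_monic {F : Type} [Field F] {d : ℕ} (c : Fin d → F) : (mP F d c).Monic :=
  monic_X_pow_add (degree_sum_fin_lt c)

theorem degree_mP {F : Type} [Field F] {d : ℕ} (c : Fin d → F) : (mP F d c).degree = d := by
  rw [mP, degree_add_eq_left_of_degree_lt] <;> simp [degree_sum_fin_lt]

theorem aK_mP_ne_zero {F : Type} [Field F] {d : ℕ} (c : Fin d → F) : aK F (mP F d c) ≠ 0 := by
  simpa [aK] using (mP_monic c).ne_zero

theorem aK_mP {F : Type} [Field F] {d : ℕ} (c : Fin d → F) : aK F (mP F d c) =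
    th F ^ d + ∑ i : Fin d, algebraMap F (RatFunc F) (c i) * th F ^ (i : ℕ) := by
  simp only [aK, mP, th, map_add, map_sum, map_mul, map_pow]
  rfl

theorem eval₂_FqK_th_pow (a : Fq[X]) (k : ℕ) :
    a.eval₂ (FqK Fq) (th Fq ^ q Fq ^ k) = aK Fq a ^ q Fq ^ k := by
  change aeval (th Fq ^ q Fq ^ k) a = _
  induction k with
  | zero =>
    rw [pow_zero, pow_one, pow_one, th, aeval_algebraMap_apply, aeval_X_left_apply, aK]
  | succ k ih =>
    rw [pow_succ, pow_mul, pow_mul, ← ih]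
    simpa using aeval_algHom_apply (FiniteField.frobeniusAlgHom Fq (RatFunc Fq))
      (th Fq ^ q Fq ^ k) a

/-- The value `a(t_i)` of a monic `a` of degree `d` is `b_d(t_i) + ∑_k a ^ (q ^ k) Q_{d,k}(t_i)`. -/
theorem tval_mP {d : ℕ} (c : Fin d → Fq) (i : ℕ+) :
    tval Fq i (mP Fq d c) = bMv Fq d i +
      ∑ k : Fin d, MvPolynomial.C (aK Fq (mP Fq d c) ^ q Fq ^ (k : ℕ)) * Q Fq d k i := by
  set a := mP Fq d c with ha
  set P : (RatFunc Fq)[X] := a.map (FqK Fq) with hP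
  have hPd : P.degree < (d + 1 : ℕ) := by
    rw [hP, degree_map, ha, degree_mP]; exact_mod_cast Nat.lt_succ_self d
  have htop := Lagrange.coeff_eq_sum (s := range (d + 1)) (injective_th_pow Fq).injOn (P := P)
    (by simpa using hPd)
  have hlead : P.coeff d = 1 := by
    have := (mP_monic c).coeff_natDegree
    rw [natDegree_eq_of_degree_eq_some (degree_mP c)] at this
    rw [hP, coeff_map, ha, this, map_one]
  have hev (k : ℕ) : P.eval (th Fq ^ q Fq ^ k) = aK Fq a ^ q Fq ^ k := by
    rw [hP, eval_map, eval₂_FqK_th_pow]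
  rw [card_range, Nat.add_sub_cancel, hlead] at htop
  have hN := eq_sum_dividedDifference_mul_nodal (injective_th_pow Fq) (d + 1) P hPd
  rw [sum_range_succ, ← htop, map_one, one_mul] at hN
  have ht : tval Fq i a = P.eval₂ MvPolynomial.C (MvPolynomial.X i) := by
    rw [hP, eval₂_map]; rfl
  have hb (j : ℕ) : (∏ m ∈ range j, (Polynomial.X - Polynomial.C (th Fq ^ q Fq ^ m))).eval₂
      MvPolynomial.C (MvPolynomial.X i) = bMv Fq j i := by
    rw [eval₂_finsetProd, bMv]
    exact prod_congr rfl fun m _ => by rw [eval₂_sub, eval₂_X, eval₂_C]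
  rw [ht, hN, eval₂_add, hb, add_comm, eval₂_finsetSum, Fin.sum_univ_eq_sum_range
    (fun k => MvPolynomial.C (aK Fq a ^ q Fq ^ k) * Q Fq d k i)]
  congr 1
  simp only [eval₂_mul, hb, eval₂_C, hev, Q]
  simp only [map_sum, sum_mul, mul_sum]
  rw [sum_comm' (t' := range d) (s' := fun k => Ico k d)
    (by intro j k; simp only [mem_range, mem_Ico]; omega)]
  refine sum_congr rfl fun k _ => sum_congr rfl fun j hj => ?_
  rw [prod_erase_sub_th_pow Fq (mem_Ico.1 hj).1, div_eq_mul_inv, map_mul, mul_assoc]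

/-- Positive power sums of monic polynomials of degree `d = e + 1` vanish for exponents below
`(q - 1) q ^ e`. -/
theorem sum_aK_mP_pow_eq_zero {e m : ℕ} (hm : m < (q Fq - 1) * q Fq ^ e) :
    ∑ c : Fin (e + 1) → Fq, aK Fq (mP Fq (e + 1) c) ^ m = 0 := by
  obtain ⟨f, hf, hfx⟩ := exists_totalDegree_lt_eval_eq_pow (k := Fq) e m hm
    (th Fq ^ (e + 1)) (fun i : Fin (e + 1) => th Fq ^ (i : ℕ))
  simp only [aK_mP, ← hfx]
  exact sum_eval₂_eq_zero _ f (by simpa using hf)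

/-- The exponents occurring in the expansion of the power sum either give a power sum with positive
argument or contribute nothing. -/
theorem sum_aK_mP_pow_mul_inv {d n : ℕ} {ι : Type*} [Fintype ι] (hι : Fintype.card ι < q Fq)
    (k : ι → Fin d) :
    ∑ c : Fin d → Fq, aK Fq (mP Fq d c) ^ (∑ i, q Fq ^ (k i : ℕ)) *
        (aK Fq (mP Fq d c) ^ (n + 1))⁻¹ =
      if ∑ i, q Fq ^ (k i : ℕ) ≤ n then Ssc Fq d (n - ∑ i, q Fq ^ (k i : ℕ) + 1) else 0 := by
  set M := ∑ i, q Fq ^ (k i : ℕ) with hM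
  split_ifs with h
  · refine sum_congr rfl fun c _ => ?_
    have h0 := aK_mP_ne_zero c
    rw [show n + 1 = M + (n - M + 1) by omega, pow_add]
    field_simp
  · have hsum : ∑ c : Fin d → Fq, aK Fq (mP Fq d c) ^ M * (aK Fq (mP Fq d c) ^ (n + 1))⁻¹ =
        ∑ c : Fin d → Fq, aK Fq (mP Fq d c) ^ (M - (n + 1)) := by
      refine sum_congr rfl fun c _ => ?_
      rw [← pow_sub₀ _ (aK_mP_ne_zero c) (by omega)]
    rw [hsum]
    obtain ⟨i⟩ : Nonempty ι := by
      by_contra hne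
      rw [not_nonempty_iff] at hne
      simp [hM] at h
    obtain ⟨e, rfl⟩ : ∃ e, d = e + 1 := ⟨d - 1, by have := (k i).2; omega⟩
    refine sum_aK_mP_pow_eq_zero Fq ?_
    have hle : M ≤ (q Fq - 1) * q Fq ^ e := by
      calc M ≤ ∑ _i : ι, q Fq ^ e := sum_le_sum fun i _ =>
            Nat.pow_le_pow_right Fintype.card_pos (by have := (k i).2; omega)
        _ = Fintype.card ι * q Fq ^ e := by simp
        _ ≤ _ := Nat.mul_le_mul_right _ (by omega)
    omega

theorem statement11 (Sg : Finset ℕ+) (hSg : Sg.card < q Fq) (n d : ℕ) :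
    SdF Fq d Sg (n + 1) =
      MvPolynomial.C (Ssc Fq d (n + 1)) * ∏ i ∈ Sg, bMv Fq d i +
      ∑ J ∈ Sg.powerset.erase Sg, ∑ k : {i // i ∈ Sg \ J} → Fin d,
        if (∑ i, q Fq ^ ((k i : ℕ))) ≤ n then
          MvPolynomial.C (Ssc Fq d (n - (∑ i, q Fq ^ ((k i : ℕ))) + 1)) *
            (∏ i, Q Fq d ((k i : ℕ)) i.1) * ∏ i ∈ J, bMv Fq d i
        else 0 := by
  set T : Finset ℕ+ → MvPolynomial ℕ+ (RatFunc Fq) := fun J =>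
    ∑ k : {i // i ∈ Sg \ J} → Fin d,
      if (∑ i, q Fq ^ ((k i : ℕ))) ≤ n then
        MvPolynomial.C (Ssc Fq d (n - (∑ i, q Fq ^ ((k i : ℕ))) + 1)) *
          (∏ i, Q Fq d ((k i : ℕ)) i.1) * ∏ i ∈ J, bMv Fq d i
      else 0 with hT
  have hTop : T Sg = MvPolynomial.C (Ssc Fq d (n + 1)) * ∏ i ∈ Sg, bMv Fq d i := by
    have : IsEmpty {i // i ∈ Sg \ Sg} := ⟨fun i => by simpa using i.2⟩
    simp only [hT, Fintype.sum_unique, univ_eq_empty, sum_empty, prod_empty, Nat.zero_le, if_true,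
      Nat.sub_zero, mul_one]
  rw [← hTop, add_sum_erase _ T (mem_powerset_self Sg)]
  simp only [SdF, tval_mP, Finset.prod_add, sum_mul]
  rw [sum_comm]
  refine sum_congr rfl fun J hJ => ?_
  have hcard : Fintype.card {i // i ∈ Sg \ J} < q Fq := by
    rw [Fintype.card_coe]
    exact (card_le_card sdiff_subset).trans_lt hSg
  have hterm (k : {i // i ∈ Sg \ J} → Fin d) :
      (if (∑ i, q Fq ^ ((k i : ℕ))) ≤ n then
        MvPolynomial.C (Ssc Fq d (n - (∑ i, q Fq ^ ((k i : ℕ))) + 1)) *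
          (∏ i, Q Fq d ((k i : ℕ)) i.1) * ∏ i ∈ J, bMv Fq d i
      else 0) = MvPolynomial.C (∑ c : Fin d → Fq,
        aK Fq (mP Fq d c) ^ (∑ i, q Fq ^ (k i : ℕ)) * (aK Fq (mP Fq d c) ^ (n + 1))⁻¹) *
          (∏ i, Q Fq d ((k i : ℕ)) i.1) * ∏ i ∈ J, bMv Fq d i := by
    rw [sum_aK_mP_pow_mul_inv Fq hcard]
    split_ifs <;> simp
  simp only [hT, hterm, map_sum, sum_mul]
  rw [sum_comm]
  refine sum_congr rfl fun c _ => ?_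
  rw [← prod_coe_sort (Sg \ J), Fintype.prod_sum, mul_sum, sum_mul]
  refine sum_congr rfl fun k _ => ?_
  rw [prod_mul_distrib, ← map_prod, prod_pow_eq_pow_sum, map_mul]
  ring

end
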